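/- For the KKM potential V_I, the nested brackets {{A₂,B₂},B₁} and {A₂,{B₁,B₂}} are equal and satisfy {{A₂,B₂},B₁} = {{B₁,B₂},A₂} = 8A₁(B₁−F) + 8(B₁+B₂−F)(A₂−H), while {A₁,{B₁,B₂}} = {{A₁,B₁},B₂} = 8A₂(B₂−F) + 8(B₁+B₂−F)(A₁−H). -/

import Mathlib

noncomputable section

open MvPolynomial

/-- The field of rational functions over ℝ in the six variables
`x, y, z, p_x, p_y, p_z`: the fraction field of the polynomial ring. -/
abbrev K6 : Type := FractionRing (MvPolynomial (Fin 6) ℝ)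

/-- The canonical embedding of the polynomial ring into its fraction field. -/
def toK6 : MvPolynomial (Fin 6) ℝ →+* K6 :=
  algebraMap (MvPolynomial (Fin 6) ℝ) K6

/-- Constants, embedded in `K6`. -/
def cR (a : ℝ) : K6 := toK6 (MvPolynomial.C a)

def vx : K6 := toK6 (MvPolynomial.X 0)
def vy : K6 := toK6 (MvPolynomial.X 1)
def vz : K6 := toK6 (MvPolynomial.X 2)
def vpx : K6 := toK6 (MvPolynomial.X 3)
def vpy : K6 := toK6 (MvPolynomial.X 4)
def vpz : K6 := toK6 (MvPolynomial.X 5)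

/-- `D` is the (unique) extension to the fraction field of the formal partial
derivative `pderiv j` on the polynomial ring: an additive map satisfying the
Leibniz rule which agrees with `pderiv j` on polynomials. -/
def IsPDeriv (j : Fin 6) (D : K6 → K6) : Prop :=
  (∀ f g : K6, D (f + g) = D f + D g) ∧
  (∀ f g : K6, D (f * g) = D f * g + f * D g) ∧
  (∀ p, D (toK6 p) = toK6 (pderiv j p))

/-- The canonical Poisson bracket on `K6`, where `Pd 0, …, Pd 5` are the
partial derivatives with respect to `x, y, z, p_x, p_y, p_z` respectively:
`{f,g} = f_x g_{p_x} + f_y g_{p_y} + f_z g_{p_z}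
  - f_{p_x} g_x - f_{p_y} g_y - f_{p_z} g_z`. -/
def poisson (Pd : Fin 6 → K6 → K6) (f g : K6) : K6 :=
  Pd 0 f * Pd 3 g + Pd 1 f * Pd 4 g + Pd 2 f * Pd 5 g
    - Pd 3 f * Pd 0 g - Pd 4 f * Pd 1 g - Pd 5 f * Pd 2 g

/-- Angular momentum `J_x = y p_z - z p_y`. -/
def Jx : K6 := vy * vpz - vz * vpy
/-- Angular momentum `J_y = z p_x - x p_z`. -/
def Jy : K6 := vz * vpx - vx * vpz
/-- Angular momentum `J_z = x p_y - y p_x`. -/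
def Jz : K6 := vx * vpy - vy * vpx
/-- Total angular momentum squared `J² = J_x² + J_y² + J_z²`. -/
def Jsq : K6 := Jx ^ 2 + Jy ^ 2 + Jz ^ 2

/-- KKM V_I Hamiltonian. -/
def HV (α₁ α₂ α₃ δ : ℝ) : K6 :=
  vpx ^ 2 + vpy ^ 2 + vpz ^ 2 + cR δ * (vx ^ 2 + vy ^ 2 + vz ^ 2)
    + cR α₁ / vx ^ 2 + cR α₂ / vy ^ 2 + cR α₃ / vz ^ 2

def A1V (α₁ δ : ℝ) : K6 := vpx ^ 2 + cR δ * vx ^ 2 + cR α₁ / vx ^ 2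

def A2V (α₃ δ : ℝ) : K6 := vpz ^ 2 + cR δ * vz ^ 2 + cR α₃ / vz ^ 2

def B1V (α₁ α₂ : ℝ) : K6 :=
  Jz ^ 2 + cR α₂ * vx ^ 2 / vy ^ 2 + cR α₁ * vy ^ 2 / vx ^ 2

def B2V (α₂ α₃ : ℝ) : K6 :=
  Jx ^ 2 + cR α₃ * vy ^ 2 / vz ^ 2 + cR α₂ * vz ^ 2 / vy ^ 2

def FV (α₁ α₂ α₃ : ℝ) : K6 :=
  Jsq + cR α₂ * (vx ^ 2 + vz ^ 2) / vy ^ 2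
    + (cR α₃ * vx ^ 2 * (vx ^ 2 + vy ^ 2) + cR α₁ * vz ^ 2 * (vy ^ 2 + vz ^ 2))
      / (vx ^ 2 * vz ^ 2)

lemma toK6_X_ne_zero (i : Fin 6) : toK6 (X i) ≠ 0 := by
  simp [toK6]

section Coordinates

variable {K : Type*} [Field K]

/-- An additive self-map of a field satisfying the Leibniz rule, as a derivation over `ℤ`. -/
def derivationOfLeibniz (D : K → K) (hadd : ∀ f g, D (f + g) = D f + D g)
    (hmul : ∀ f g, D (f * g) = D f * g + f * D g) : Derivation ℤ K K :=
  Derivation.mk' (AddMonoidHom.mk' D hadd).toIntLinearMap fun a b => by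
    simp [hmul a b, mul_comm, add_comm]

/-- The canonical Poisson bracket attached to six derivations of a field. -/
def derivationBracket (d : Fin 6 → Derivation ℤ K K) (f g : K) : K :=
  d 0 f * d 3 g + d 1 f * d 4 g + d 2 f * d 5 g
    - d 3 f * d 0 g - d 4 f * d 1 g - d 5 f * d 2 g

/-- The hypotheses on six derivations of a field which make `x 0, …, x 5` canonical coordinates
and the parameters `a₁ a₂ a₃ e` constants. -/
structure IsCanonical (d : Fin 6 → Derivation ℤ K K) (x : Fin 6 → K) (a₁ a₂ a₃ e : K) : Prop where
  ne_zero : ∀ i, x i ≠ 0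
  coord : ∀ j i, d j (x i) = if i = j then 1 else 0
  const₁ : ∀ j, d j a₁ = 0
  const₂ : ∀ j, d j a₂ = 0
  const₃ : ∀ j, d j a₃ = 0
  const_e : ∀ j, d j e = 0

/-- The generators of the symmetry algebra of the potential V_I, in canonical coordinates `x`. -/
structure IsPotentialVI (d : Fin 6 → Derivation ℤ K K) (x : Fin 6 → K)
    (a₁ a₂ a₃ e A₁ A₂ B₁ B₂ H F : K) : Prop extends IsCanonical d x a₁ a₂ a₃ e where
  A₁_eq : A₁ = x 3 ^ 2 + e * x 0 ^ 2 + a₁ / x 0 ^ 2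
  A₂_eq : A₂ = x 5 ^ 2 + e * x 2 ^ 2 + a₃ / x 2 ^ 2
  B₁_eq : B₁ = (x 0 * x 4 - x 1 * x 3) ^ 2 + a₂ * x 0 ^ 2 / x 1 ^ 2 + a₁ * x 1 ^ 2 / x 0 ^ 2
  B₂_eq : B₂ = (x 1 * x 5 - x 2 * x 4) ^ 2 + a₃ * x 1 ^ 2 / x 2 ^ 2 + a₂ * x 2 ^ 2 / x 1 ^ 2
  H_eq : H = x 3 ^ 2 + x 4 ^ 2 + x 5 ^ 2 + e * (x 0 ^ 2 + x 1 ^ 2 + x 2 ^ 2)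
      + a₁ / x 0 ^ 2 + a₂ / x 1 ^ 2 + a₃ / x 2 ^ 2
  F_eq : F = (x 1 * x 5 - x 2 * x 4) ^ 2 + (x 2 * x 3 - x 0 * x 5) ^ 2 + (x 0 * x 4 - x 1 * x 3) ^ 2
      + a₂ * (x 0 ^ 2 + x 2 ^ 2) / x 1 ^ 2
      + (a₃ * x 0 ^ 2 * (x 0 ^ 2 + x 1 ^ 2) + a₁ * x 2 ^ 2 * (x 1 ^ 2 + x 2 ^ 2))
        / (x 0 ^ 2 * x 2 ^ 2)

variable {d : Fin 6 → Derivation ℤ K K} {x : Fin 6 → K} {a₁ a₂ a₃ e A₁ A₂ B₁ B₂ H F : K}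

lemma IsPotentialVI.bracket_A₂_B₂ (h : IsPotentialVI d x a₁ a₂ a₃ e A₁ A₂ B₁ B₂ H F) :
    derivationBracket d A₂ B₂ =
      4 * ((x 4 * x 5 + e * x 1 * x 2) * (x 1 * x 5 - x 2 * x 4)
        + a₃ * x 1 * x 4 / x 2 ^ 2 - a₂ * x 2 * x 5 / x 1 ^ 2) := by
  rw [h.A₂_eq, h.B₂_eq]
  have := h.ne_zero 0
  have := h.ne_zero 1
  have := h.ne_zero 2
  simp [derivationBracket, Derivation.leibniz, Derivation.leibniz_pow, Derivation.leibniz_div,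
    h.coord, h.const₂, h.const₃, h.const_e]
  field_simp
  ring

lemma IsPotentialVI.bracket_A₁_B₁ (h : IsPotentialVI d x a₁ a₂ a₃ e A₁ A₂ B₁ B₂ H F) :
    derivationBracket d A₁ B₁ =
      4 * (-(x 3 * x 4 + e * x 0 * x 1) * (x 0 * x 4 - x 1 * x 3)
        + a₁ * x 1 * x 4 / x 0 ^ 2 - a₂ * x 0 * x 3 / x 1 ^ 2) := by
  rw [h.A₁_eq, h.B₁_eq]
  have := h.ne_zero 0
  have := h.ne_zero 1
  have := h.ne_zero 2
  simp [derivationBracket, Derivation.leibniz, Derivation.leibniz_pow, Derivation.leibniz_div,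
    h.coord, h.const₁, h.const₂, h.const_e]
  field_simp
  ring

lemma IsPotentialVI.bracket_B₁_B₂ (h : IsPotentialVI d x a₁ a₂ a₃ e A₁ A₂ B₁ B₂ H F) :
    derivationBracket d B₁ B₂ =
      4 * ((x 1 * x 5 - x 2 * x 4) * (x 2 * x 3 - x 0 * x 5) * (x 0 * x 4 - x 1 * x 3)
        - a₁ * x 1 * x 2 * (x 1 * x 5 - x 2 * x 4) / x 0 ^ 2
        - a₂ * x 0 * x 2 * (x 2 * x 3 - x 0 * x 5) / x 1 ^ 2
        - a₃ * x 0 * x 1 * (x 0 * x 4 - x 1 * x 3) / x 2 ^ 2) := by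
  rw [h.B₁_eq, h.B₂_eq]
  have := h.ne_zero 0
  have := h.ne_zero 1
  have := h.ne_zero 2
  simp [derivationBracket, Derivation.leibniz, Derivation.leibniz_pow, Derivation.leibniz_div,
    h.coord, h.const₁, h.const₂, h.const₃]
  field_simp
  ring

lemma IsPotentialVI.bracket_bracket_A₂_B₂_B₁ (h : IsPotentialVI d x a₁ a₂ a₃ e A₁ A₂ B₁ B₂ H F) :
    derivationBracket d (derivationBracket d A₂ B₂) B₁ =
      8 * A₁ * (B₁ - F) + 8 * (B₁ + B₂ - F) * (A₂ - H) := by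
  rw [h.bracket_A₂_B₂, h.A₁_eq, h.A₂_eq, h.B₁_eq, h.B₂_eq, h.H_eq, h.F_eq]
  have := h.ne_zero 0
  have := h.ne_zero 1
  have := h.ne_zero 2
  have h4 : ∀ j, d j 4 = 0 := fun j => by exact_mod_cast (d j).map_natCast 4
  simp [derivationBracket, Derivation.leibniz, Derivation.leibniz_pow, Derivation.leibniz_div,
    h.coord, h.const₁, h.const₂, h.const₃, h.const_e, h4]
  field_simp
  ring

lemma IsPotentialVI.bracket_bracket_B₁_B₂_A₂ (h : IsPotentialVI d x a₁ a₂ a₃ e A₁ A₂ B₁ B₂ H F) :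
    derivationBracket d (derivationBracket d B₁ B₂) A₂ =
      8 * A₁ * (B₁ - F) + 8 * (B₁ + B₂ - F) * (A₂ - H) := by
  rw [h.bracket_B₁_B₂, h.A₁_eq, h.A₂_eq, h.B₁_eq, h.B₂_eq, h.H_eq, h.F_eq]
  have := h.ne_zero 0
  have := h.ne_zero 1
  have := h.ne_zero 2
  have h4 : ∀ j, d j 4 = 0 := fun j => by exact_mod_cast (d j).map_natCast 4
  simp [derivationBracket, Derivation.leibniz, Derivation.leibniz_pow, Derivation.leibniz_div,
    h.coord, h.const₁, h.const₂, h.const₃, h.const_e, h4]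
  field_simp
  ring

lemma IsPotentialVI.bracket_A₁_bracket_B₁_B₂ (h : IsPotentialVI d x a₁ a₂ a₃ e A₁ A₂ B₁ B₂ H F) :
    derivationBracket d A₁ (derivationBracket d B₁ B₂) =
      8 * A₂ * (B₂ - F) + 8 * (B₁ + B₂ - F) * (A₁ - H) := by
  rw [h.bracket_B₁_B₂, h.A₁_eq, h.A₂_eq, h.B₁_eq, h.B₂_eq, h.H_eq, h.F_eq]
  have := h.ne_zero 0
  have := h.ne_zero 1
  have := h.ne_zero 2
  have h4 : ∀ j, d j 4 = 0 := fun j => by exact_mod_cast (d j).map_natCast 4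
  simp [derivationBracket, Derivation.leibniz, Derivation.leibniz_pow, Derivation.leibniz_div,
    h.coord, h.const₁, h.const₂, h.const₃, h.const_e, h4]
  field_simp
  ring

lemma IsPotentialVI.bracket_bracket_A₁_B₁_B₂ (h : IsPotentialVI d x a₁ a₂ a₃ e A₁ A₂ B₁ B₂ H F) :
    derivationBracket d (derivationBracket d A₁ B₁) B₂ =
      8 * A₂ * (B₂ - F) + 8 * (B₁ + B₂ - F) * (A₁ - H) := by
  rw [h.bracket_A₁_B₁, h.A₁_eq, h.A₂_eq, h.B₁_eq, h.B₂_eq, h.H_eq, h.F_eq]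
  have := h.ne_zero 0
  have := h.ne_zero 1
  have := h.ne_zero 2
  have h4 : ∀ j, d j 4 = 0 := fun j => by exact_mod_cast (d j).map_natCast 4
  simp [derivationBracket, Derivation.leibniz, Derivation.leibniz_pow, Derivation.leibniz_div,
    h.coord, h.const₁, h.const₂, h.const₃, h.const_e, h4]
  field_simp
  ring

end Coordinates

theorem kkm_VI_nested_B (α₁ α₂ α₃ δ : ℝ) (Pd : Fin 6 → K6 → K6)
    (hPd : ∀ j, IsPDeriv j (Pd j))
    (H A1 A2 B1 B2 F : K6)
    (hH : H = HV α₁ α₂ α₃ δ) (hA1 : A1 = A1V α₁ δ) (hA2 : A2 = A2V α₃ δ)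
    (hB1 : B1 = B1V α₁ α₂) (hB2 : B2 = B2V α₂ α₃) (hF : F = FV α₁ α₂ α₃) :
    poisson Pd (poisson Pd A2 B2) B1 =
      8 * A1 * (B1 - F) + 8 * (B1 + B2 - F) * (A2 - H) ∧
    poisson Pd (poisson Pd B1 B2) A2 =
      8 * A1 * (B1 - F) + 8 * (B1 + B2 - F) * (A2 - H) ∧
    poisson Pd A1 (poisson Pd B1 B2) =
      8 * A2 * (B2 - F) + 8 * (B1 + B2 - F) * (A1 - H) ∧
    poisson Pd (poisson Pd A1 B1) B2 =
      8 * A2 * (B2 - F) + 8 * (B1 + B2 - F) * (A1 - H) := by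
  let d := fun j => derivationOfLeibniz (Pd j) (hPd j).1 (hPd j).2.1
  have hc : ∀ a j, d j (cR a) = 0 := fun a j =>
    ((hPd j).2.2 (C a)).trans (by rw [pderiv_C, map_zero])
  have h : IsPotentialVI d (fun i => toK6 (X i)) (cR α₁) (cR α₂) (cR α₃) (cR δ)
      A1 A2 B1 B2 H F :=
    { ne_zero := toK6_X_ne_zero
      coord := fun j i => ((hPd j).2.2 (X i)).trans (by
        rw [pderiv_X, Pi.single_apply, apply_ite toK6, map_one, map_zero])
      const₁ := hc α₁
      const₂ := hc α₂
      const₃ := hc α₃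
      const_e := hc δ
      A₁_eq := hA1
      A₂_eq := hA2
      B₁_eq := hB1
      B₂_eq := hB2
      H_eq := hH
      F_eq := hF }
  exact ⟨h.bracket_bracket_A₂_B₂_B₁,
    h.bracket_bracket_B₁_B₂_A₂,
    h.bracket_A₁_bracket_B₁_B₂,
    h.bracket_bracket_A₁_B₁_B₂⟩
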